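/- Let T>0, x∈ℝ, and let η,λ,κ>0 be constants. Set α₊=(κ+√(κ²+16ηλ))/(4η) and α₋=(κ−√(κ²+16ηλ))/(4η). Define A(t)=2η(α₊e^{α₊T}e^{α₋t}−α₋e^{α₋T}e^{α₊t})/(e^{α₊T}e^{α₋t}−e^{α₋T}e^{α₊t}) and X*(t)=x(e^{α₊(T−t)}−e^{α₋(T−t)})/(e^{α₊T}−e^{α₋T}). Then X* is continuously differentiable on [0,T] with X*'(t)=−A(t)X*(t)/(2η) for all t∈[0,T), X*(0)=x, and X*(T)=0. -/

import Mathlib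

open MeasureTheory Set Filter Real
open scoped Topology

/-- The derivative of the normalized difference of exponentials
`t ↦ x (e^{p(T-t)} - e^{m(T-t)}) / (e^{pT} - e^{mT})`. -/
theorem hasDerivAt_exp_sub_exp_div (x p m T t : ℝ) :
    HasDerivAt (fun s => x * (Real.exp (p * (T - s)) - Real.exp (m * (T - s))) /
        (Real.exp (p * T) - Real.exp (m * T)))
      (-(x * (p * Real.exp (p * (T - t)) - m * Real.exp (m * (T - t))) /
        (Real.exp (p * T) - Real.exp (m * T)))) t := by
  have hexp (c : ℝ) :
      HasDerivAt (fun s => Real.exp (c * (T - s))) (Real.exp (c * (T - t)) * (c * -1)) t :=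
    (((hasDerivAt_id t).const_sub T).const_mul c).exp
  refine ((((hexp p).sub (hexp m)).const_mul x).div_const
    (Real.exp (p * T) - Real.exp (m * T))).congr_deriv ?_
  ring

/-- Factoring `e^{(p+m)t}` out of a combination of `e^{pT+mt}` and `e^{mT+pt}`. -/
theorem exp_combination_factor (a b p m T t : ℝ) :
    a * Real.exp (p * T) * Real.exp (m * t) - b * Real.exp (m * T) * Real.exp (p * t) =
      Real.exp ((p + m) * t) *
        (a * Real.exp (p * (T - t)) - b * Real.exp (m * (T - t))) := by
  have hp : Real.exp (p * T) * Real.exp (m * t) =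
      Real.exp ((p + m) * t) * Real.exp (p * (T - t)) := by
    rw [← Real.exp_add, ← Real.exp_add]; ring_nf
  have hm : Real.exp (m * T) * Real.exp (p * t) =
      Real.exp ((p + m) * t) * Real.exp (m * (T - t)) := by
    rw [← Real.exp_add, ← Real.exp_add]; ring_nf
  linear_combination a * hp - b * hm

/-- The explicit optimal position in the constant-coefficient benchmark example solves
`X*' = -A X*/(2η)`, `X*(0) = x`, `X*(T) = 0`. -/
theorem stmt_10 (T x η lam κ αp αm : ℝ) (hT : 0 < T) (hη : 0 < η) (hlam : 0 < lam) (hκ : 0 < κ)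
    (hαp : αp = (κ + Real.sqrt (κ ^ 2 + 16 * η * lam)) / (4 * η))
    (hαm : αm = (κ - Real.sqrt (κ ^ 2 + 16 * η * lam)) / (4 * η))
    (A Xstar : ℝ → ℝ)
    (hA : ∀ t, A t =
      2 * η * (αp * Real.exp (αp * T) * Real.exp (αm * t) -
        αm * Real.exp (αm * T) * Real.exp (αp * t)) /
      (Real.exp (αp * T) * Real.exp (αm * t) - Real.exp (αm * T) * Real.exp (αp * t)))
    (hX : ∀ t, Xstar t =
      x * (Real.exp (αp * (T - t)) - Real.exp (αm * (T - t))) /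
        (Real.exp (αp * T) - Real.exp (αm * T))) :
    (∀ t ∈ Icc (0:ℝ) T, DifferentiableAt ℝ Xstar t) ∧
    (∀ t ∈ Ico (0:ℝ) T, HasDerivAt Xstar (-(A t * Xstar t / (2 * η))) t) ∧
    Xstar 0 = x ∧ Xstar T = 0 := by
  have hlt : αm < αp := by
    have hsqrt : 0 < Real.sqrt (κ ^ 2 + 16 * η * lam) := Real.sqrt_pos.2 (by positivity)
    rw [hαp, hαm]
    gcongr
    linarith
  have hpos {s : ℝ} (hs : 0 < s) : 0 < Real.exp (αp * s) - Real.exp (αm * s) :=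
    sub_pos.2 (Real.exp_lt_exp.2 (mul_lt_mul_of_pos_right hlt hs))
  have hderiv (t : ℝ) := hasDerivAt_exp_sub_exp_div x αp αm T t
  rw [← funext hX] at hderiv
  refine ⟨fun t _ => (hderiv t).differentiableAt, fun t ht => ?_, ?_, ?_⟩
  · convert hderiv t using 1
    have hD := (hpos hT).ne'
    have hDt := (hpos (sub_pos.2 ht.2)).ne'
    have hden := exp_combination_factor 1 1 αp αm T t
    simp only [one_mul] at hden
    rw [hA, hX, hden, exp_combination_factor]
    field_simp
  · rw [hX, sub_zero, mul_div_assoc, div_self (hpos hT).ne', mul_one]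
  · simp [hX]
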